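/- arXiv:1708.09111 — 2 statements merged into one kernel-verified Lean document; each statement's English description precedes it below -/
import Mathlib

section
/- For n ≥ 3, the four-element set {φ_{(1 2)}, φ_{(1 2 ⋯ n)}, ξ_{(1,1)}, ξ_θ} generates the endomorphism semigroup End(B_n) of the Brandt semigroup B_n, where (1 2) is a transposition and (1 2 ⋯ n) is an n-cycle in S_n. -/
/-- The underlying set of the Brandt semigroup `B_n`: pairs `(i,j)` with
`i, j ∈ [n]` together with the zero element `θ` (represented by `none`). -/
abbrev Brandt (n : ℕ) := Option (Fin n × Fin n)

/-- The Brandt semigroup operation: `(i,j) + (k,l) = (i,l)` if `j = k`, and `θ`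
otherwise; `θ` is a two-sided zero. -/
def bmul {n : ℕ} : Brandt n → Brandt n → Brandt n
  | some (i, j), some (k, l) => if j = k then some (i, l) else none
  | _, _ => none

instance {n : ℕ} : Mul (Brandt n) := ⟨bmul⟩

@[simp] lemma brandt_mul_def {n : ℕ} (x y : Brandt n) : x * y = bmul x y := rfl

/-- A map `B_n → B_n` is a (semigroup) endomorphism if it preserves the operation. -/
def IsEndo {n : ℕ} (f : Brandt n → Brandt n) : Prop :=
  ∀ x y : Brandt n, f (x * y) = f x * f y

/-- `End(B_n)`: the semigroup (indeed monoid) of endomorphisms of `B_n`.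
Multiplication `f * g` is "first `f`, then `g`", the composition convention of
the paper. -/
def BrandtEnd (n : ℕ) := {f : Brandt n → Brandt n // IsEndo f}

instance {n : ℕ} : Monoid (BrandtEnd n) where
  mul f g := ⟨g.1 ∘ f.1, fun x y =>
    (congrArg g.1 (f.2 x y)).trans (g.2 _ _)⟩
  one := ⟨id, fun _ _ => rfl⟩
  mul_assoc f g h := rfl
  one_mul f := rfl
  mul_one f := rfl

/-- The zero constant endomorphism `ξ_θ`, sending every element of `B_n` to `θ`. -/
def xiTheta (n : ℕ) : BrandtEnd n := ⟨fun _ => (none : Brandt n), fun _ _ => rfl⟩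

/-- The nonzero idempotent-valued constant endomorphism `ξ_{(i,i)}`. -/
def xiDiag {n : ℕ} (i : Fin n) : BrandtEnd n :=
  ⟨fun _ => (some (i, i) : Brandt n), fun _ _ => by simp [bmul]⟩

/-- The automorphism `φ_σ` of `B_n` induced by a permutation `σ ∈ S_n`:
`(i,j) ↦ (σ i, σ j)` and `θ ↦ θ`, viewed as an element of `End(B_n)`. -/
def phiE {n : ℕ} (σ : Equiv.Perm (Fin n)) : BrandtEnd n :=
  ⟨fun x => x.map fun p => (σ p.1, σ p.2), by
    rintro (_ | ⟨i, j⟩) (_ | ⟨k, l⟩)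
    · rfl
    · rfl
    · rfl
    · rcases eq_or_ne j k with h | h
      · simp [bmul, h]
      · simp [bmul, h, σ.injective.ne h]⟩

theorem phiE_mul {n : ℕ} (σ τ : Equiv.Perm (Fin n)) : phiE (σ * τ) = phiE τ * phiE σ := by
  apply Subtype.ext
  funext x
  rcases x with _ | x <;> rfl

theorem phiE_injective {n : ℕ} : Function.Injective (phiE (n := n)) := by
  intro σ τ h
  ext i
  have := congrFun (congrArg Subtype.val h) (some (i, i))
  simp only [phiE, Option.map_some, Option.some.injEq, Prod.mk.injEq] at this
  rw [this.1]

/-- A nonzero idempotent of the Brandt semigroup is diagonal. -/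
theorem brandt_idempotent {n : ℕ} {x : Brandt n} (h : x * x = x) :
    x = none ∨ ∃ i, x = some (i, i) := by
  rcases x with _ | ⟨i, j⟩
  · exact Or.inl rfl
  · right
    by_cases hij : j = i
    · exact ⟨i, by rw [hij]⟩
    · simp [bmul, hij] at h

/-- Every endomorphism of the Brandt semigroup is constant with idempotent value or is an
automorphism induced by a permutation. -/
theorem brandtEnd_classification {n : ℕ} (f : BrandtEnd n) :
    f = xiTheta n ∨ (∃ i, f = xiDiag i) ∨ ∃ σ, f = phiE σ := by
  obtain ⟨f, hf⟩ := f
  have idem (x : Brandt n) (hx : x * x = x) : f x = none ∨ ∃ i, f x = some (i, i) :=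
    brandt_idempotent (by rw [← hf, hx])
  rcases idem none rfl with h0 | ⟨i, hi⟩
  · by_cases hz : ∃ a b, f (some (a, b)) = none
    · obtain ⟨a, b, hab⟩ := hz
      left
      apply Subtype.ext
      funext x
      rcases x with _ | ⟨c, d⟩
      · exact h0
      · have key : (some (c, d) : Brandt n) = some (c, a) * (some (a, b) * some (b, d)) := by
          simp [bmul]
        change f (some (c, d)) = none
        rw [key, hf, hf, hab]
        cases f (some (c, a)) <;> rfl
    · push Not at hz
      right; right
      have diag (i : Fin n) : ∃ j, f (some (i, i)) = some (j, j) :=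
        (idem (some (i, i)) (by simp [bmul])).resolve_left (hz i i)
      choose s hs using diag
      have hfs (i j : Fin n) : f (some (i, j)) = some (s i, s j) := by
        have h1 := hf (some (i, i)) (some (i, j))
        have h2 := hf (some (i, j)) (some (j, j))
        have h3 := hz i j
        rw [hs] at h1 h2
        rcases hv : f (some (i, j)) with _ | ⟨a, b⟩
        · exact absurd hv h3
        · simp only [brandt_mul_def, bmul, if_true, hv] at h1 h2
          split_ifs at h1 h2
          grind
      have hinj : Function.Injective s := by
        intro i j hij
        by_contra hne
        have h := hf (some (i, i)) (some (j, j))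
        simp [bmul, hne, h0, hs, hij] at h
      refine ⟨Equiv.ofBijective s (Finite.injective_iff_bijective.mp hinj), ?_⟩
      apply Subtype.ext
      funext x
      rcases x with _ | ⟨c, d⟩
      · exact h0
      · exact hfs c d
  · right; left
    refine ⟨i, Subtype.ext (funext fun x => ?_)⟩
    have h1 := hf none x
    have h2 := hf x none
    have e1 : (none : Brandt n) * x = none := by cases x <;> rfl
    have e2 : x * (none : Brandt n) = none := by cases x <;> rfl
    rw [e1, hi] at h1
    rw [e2, hi] at h2
    change f x = some (i, i)
    rcases hv : f x with _ | ⟨a, b⟩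
    · simp [hv, bmul] at h1
    · simp only [brandt_mul_def, bmul, hv] at h1 h2
      split_ifs at h1 h2
      grind

theorem closure_swap_finRotate {n : ℕ} (h0 : 0 < n) (h1 : 1 < n) :
    Subgroup.closure {Equiv.swap (⟨0, h0⟩ : Fin n) ⟨1, h1⟩, finRotate n} = ⊤ := by
  obtain ⟨m, rfl⟩ := Nat.exists_eq_add_of_le' (Nat.succ_le_of_lt h1)
  have h := Equiv.Perm.closure_cycle_adjacent_swap (isCycle_finRotate (n := m))
    support_finRotate 0
  have hrot : finRotate (m + 2) 0 = 1 := by simp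
  rw [hrot, Set.pair_comm] at h
  exact h

theorem swap_ne_finRotate {n : ℕ} (h0 : 0 < n) (h1 : 1 < n) (hn : 3 ≤ n) :
    Equiv.swap (⟨0, h0⟩ : Fin n) ⟨1, h1⟩ ≠ finRotate n := by
  obtain ⟨m, rfl⟩ := Nat.exists_eq_add_of_le' hn
  intro h
  have h2 := Equiv.congr_fun h ⟨1, h1⟩
  rw [Equiv.swap_apply_right, finRotate_apply] at h2
  have h3 := congrArg Fin.val h2
  simp [Fin.val_add, Nat.mod_eq_of_lt (show 2 < m + 3 by omega)] at h3

/-- A subsemigroup of `End(B_n)` containing the automorphisms induced by a transposition and a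
long cycle contains all automorphisms induced by permutations. -/
theorem phiE_mem_of_swap_of_finRotate {n : ℕ} (h0 : 0 < n) (h1 : 1 < n)
    {T : Subsemigroup (BrandtEnd n)}
    (hswap : phiE (Equiv.swap (⟨0, h0⟩ : Fin n) ⟨1, h1⟩) ∈ T)
    (hrot : phiE (finRotate n) ∈ T) (σ : Equiv.Perm (Fin n)) : phiE σ ∈ T := by
  have hσ : σ ∈ Subgroup.closure
      {Equiv.swap (⟨0, h0⟩ : Fin n) ⟨1, h1⟩, finRotate n} := by
    rw [closure_swap_finRotate h0 h1]; trivial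
  rw [← Subgroup.mem_toSubmonoid, Subgroup.closure_toSubmonoid_of_finite] at hσ
  induction hσ using Submonoid.closure_induction with
  | mem τ hτ =>
    rcases hτ with rfl | rfl
    · exact hswap
    · exact hrot
  | one =>
    rw [← Equiv.swap_mul_self (⟨0, h0⟩ : Fin n) ⟨1, h1⟩, phiE_mul]
    exact T.mul_mem hswap hswap
  | mul τ ρ _ _ hτ hρ =>
    rw [phiE_mul]
    exact T.mul_mem hρ hτ

theorem phiE_ne_xiTheta {n : ℕ} (σ : Equiv.Perm (Fin n)) (i : Fin n) : phiE σ ≠ xiTheta n :=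
  fun h => Option.some_ne_none _ (congrFun (congrArg Subtype.val h) (some (i, i)))

theorem phiE_ne_xiDiag {n : ℕ} (σ : Equiv.Perm (Fin n)) (i : Fin n) : phiE σ ≠ xiDiag i :=
  fun h => Option.some_ne_none _ (congrFun (congrArg Subtype.val h) none).symm

theorem xiDiag_ne_xiTheta {n : ℕ} (i : Fin n) : xiDiag i ≠ xiTheta n :=
  fun h => Option.some_ne_none _ (congrFun (congrArg Subtype.val h) none)

theorem xiDiag_mul_phiE {n : ℕ} (i : Fin n) (σ : Equiv.Perm (Fin n)) :
    xiDiag i * phiE σ = xiDiag (σ i) := rfl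

/-- For `n ≥ 3`, the four-element set `{φ_(1 2), φ_(1 2 ⋯ n), ξ_(1,1), ξ_θ}`
generates the endomorphism semigroup `End(B_n)`. -/
theorem four_element_generating_set (n : ℕ) (hn : 3 ≤ n)
    (S : Set (BrandtEnd n))
    (hSdef : S = {phiE (Equiv.swap (⟨0, by omega⟩ : Fin n) (⟨1, by omega⟩ : Fin n)),
      phiE (finRotate n), xiDiag (⟨0, by omega⟩ : Fin n), xiTheta n}) :
    S.ncard = 4 ∧ Subsemigroup.closure S = ⊤ := by
  refine ⟨?_, ?_⟩
  · have i0 : Fin n := ⟨0, by omega⟩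
    rw [hSdef, Set.ncard_insert_of_notMem, Set.ncard_insert_of_notMem,
      Set.ncard_pair (xiDiag_ne_xiTheta _)]
    · simp [phiE_ne_xiDiag, phiE_ne_xiTheta _ i0]
    · simp [phiE_ne_xiDiag, phiE_ne_xiTheta _ i0, phiE_injective.ne (swap_ne_finRotate _ _ hn)]
  · rw [eq_top_iff]
    intro f _
    have hphi := phiE_mem_of_swap_of_finRotate (T := Subsemigroup.closure S)
      (by omega) (by omega)
      (Subsemigroup.subset_closure (by simp [hSdef]))
      (Subsemigroup.subset_closure (by simp [hSdef]))
    rcases brandtEnd_classification f with rfl | ⟨i, rfl⟩ | ⟨σ, rfl⟩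
    · exact Subsemigroup.subset_closure (by simp [hSdef])
    · rw [← Equiv.swap_apply_left (⟨0, by omega⟩ : Fin n) i, ← xiDiag_mul_phiE]
      exact Subsemigroup.mul_mem _ (Subsemigroup.subset_closure (by simp [hSdef])) (hphi _)
    · exact hphi σ
end

section
/- The lower rank of the endomorphism semigroup of the Brandt semigroup B_2 equals 3: r_2(End(B_2)) = 3. -/
namespace BrandtEnd

instance : Finite (BrandtEnd 2) :=
  inferInstanceAs (Finite {f : Brandt 2 → Brandt 2 // IsEndo f})

instance : DecidableEq (BrandtEnd 2) :=
  inferInstanceAs (DecidableEq {f : Brandt 2 → Brandt 2 // IsEndo f})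

/-- The automorphism of `B_n` induced by a permutation of the indices. -/
def ofPerm {n : ℕ} (σ : Equiv.Perm (Fin n)) : BrandtEnd n :=
  ⟨Option.map (Prod.map σ σ), by
    rintro (_ | ⟨i, j⟩) (_ | ⟨k, l⟩) <;> simp [bmul]⟩

/-- The constant endomorphism of `B_n` with value an idempotent. -/
def const {n : ℕ} (x : Brandt n) (hx : bmul x x = x) : BrandtEnd n :=
  ⟨fun _ => x, fun _ _ => hx.symm⟩

/-- The nontrivial automorphism of `B_2`, exchanging the two indices. -/
abbrev swapEnd : BrandtEnd 2 := ofPerm (Equiv.swap 0 1)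

/-- The constant endomorphism of `B_2` with value `θ`. -/
abbrev constZero : BrandtEnd 2 := const none rfl

/-- The constant endomorphism of `B_2` with value `(i,i)`. -/
abbrev constDiag (i : Fin 2) : BrandtEnd 2 := const (some (i, i)) (by simp [bmul])

theorem ext_two {f g : BrandtEnd 2} (h : f.1 none = g.1 none)
    (h00 : f.1 (some (0, 0)) = g.1 (some (0, 0)))
    (h01 : f.1 (some (0, 1)) = g.1 (some (0, 1)))
    (h10 : f.1 (some (1, 0)) = g.1 (some (1, 0)))
    (h11 : f.1 (some (1, 1)) = g.1 (some (1, 1))) : f = g := by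
  refine Subtype.ext (funext ?_)
  rintro (_ | ⟨i, j⟩)
  · exact h
  · fin_cases i <;> fin_cases j <;> assumption

set_option synthInstance.maxSize 1000 in
/-- The possible images of `θ, (1,1), (1,2), (2,1), (2,2)` under an endomorphism of `B_2`. -/
theorem values_two :
    ∀ a : Brandt 2, bmul a a = a → ∀ b : Brandt 2, bmul b b = b → bmul a b = a →
    ∀ c : Brandt 2, bmul b c = c → bmul c c = a → bmul a c = a →
    ∀ d : Brandt 2, bmul c d = b → bmul d b = d →
    ∀ e : Brandt 2, bmul d c = e →
      (a = none ∧ b = some (0, 0) ∧ c = some (0, 1) ∧ d = some (1, 0) ∧ e = some (1, 1)) ∨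
      (a = none ∧ b = some (1, 1) ∧ c = some (1, 0) ∧ d = some (0, 1) ∧ e = some (0, 0)) ∨
      (a = none ∧ b = none ∧ c = none ∧ d = none ∧ e = none) ∨
      (∃ i : Fin 2, a = some (i, i) ∧ b = some (i, i) ∧ c = some (i, i) ∧ d = some (i, i) ∧
        e = some (i, i)) := by
  decide

theorem classification_two (f : BrandtEnd 2) :
    f = 1 ∨ f = swapEnd ∨ f = constZero ∨ f = constDiag 0 ∨ f = constDiag 1 := by
  have h := fun x y => (f.2 x y).symm
  simp only [brandt_mul_def] at h
  rcases values_two _ (h none none) _ (h (some (0, 0)) (some (0, 0))) (h none _)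
    _ (h _ (some (0, 1))) (h _ _) (h none _)
    _ (h _ (some (1, 0))) (h _ _) _ (h _ _) with
    ⟨ha, hb, hc, hd, he⟩ | ⟨ha, hb, hc, hd, he⟩ | ⟨ha, hb, hc, hd, he⟩ | ⟨i, ha, hb, hc, hd, he⟩
  · exact .inl (ext_two ha hb hc hd he)
  · exact .inr (.inl (ext_two ha hb hc hd he))
  · exact .inr (.inr (.inl (ext_two ha hb hc hd he)))
  · have hf : f = constDiag i := ext_two ha hb hc hd he
    fin_cases i
    · exact .inr (.inr (.inr (.inl hf)))
    · exact .inr (.inr (.inr (.inr hf)))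

theorem closure_generators_two :
    Subsemigroup.closure ({swapEnd, constZero, constDiag 0} : Set (BrandtEnd 2)) = ⊤ := by
  set S := Subsemigroup.closure ({swapEnd, constZero, constDiag 0} : Set (BrandtEnd 2))
  have hswap : swapEnd ∈ S := Subsemigroup.subset_closure (by simp)
  have hzero : constZero ∈ S := Subsemigroup.subset_closure (by simp)
  have hdiag : constDiag 0 ∈ S := Subsemigroup.subset_closure (by simp)
  refine eq_top_iff.mpr fun f _ => ?_
  rcases classification_two f with rfl | rfl | rfl | rfl | rfl
  · have h : swapEnd * swapEnd = 1 := by decide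
    exact h ▸ S.mul_mem hswap hswap
  · exact hswap
  · exact hzero
  · exact hdiag
  · have h : constDiag 0 * swapEnd = constDiag 1 := by decide
    exact h ▸ S.mul_mem hdiag hswap

end BrandtEnd

/-- A generating set meets the complement of every multiplicatively closed proper subset. -/
theorem Subsemigroup.exists_mem_not_of_closure_eq_top {M : Type*} [Mul M] {U : Set M}
    (hU : closure U = ⊤) {p : M → Prop} (hmul : ∀ x y, p x → p y → p (x * y))
    {z : M} (hz : ¬ p z) : ∃ x ∈ U, ¬ p x := by
  by_contra! h
  have hle : closure U ≤ ⟨{x | p x}, fun {x y} => hmul x y⟩ := closure_le.mpr h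
  exact hz (hle (hU ▸ mem_top z))

namespace BrandtEnd

variable {U : Set (BrandtEnd 2)}

theorem swapEnd_mem_of_closure_eq_top (hU : Subsemigroup.closure U = ⊤) : swapEnd ∈ U := by
  obtain ⟨x, hx, hne⟩ := Subsemigroup.exists_mem_not_of_closure_eq_top hU
    (p := fun f => f ≠ swapEnd) (z := swapEnd) (fun x y => by
      rcases classification_two x with rfl | rfl | rfl | rfl | rfl <;>
        rcases classification_two y with rfl | rfl | rfl | rfl | rfl <;> decide) (by simp)
  exact not_not.mp hne ▸ hx

theorem constZero_mem_of_closure_eq_top (hU : Subsemigroup.closure U = ⊤) : constZero ∈ U := by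
  obtain ⟨x, hx, hne⟩ := Subsemigroup.exists_mem_not_of_closure_eq_top hU
    (p := fun f => f ≠ constZero) (z := constZero) (fun x y => by
      rcases classification_two x with rfl | rfl | rfl | rfl | rfl <;>
        rcases classification_two y with rfl | rfl | rfl | rfl | rfl <;> decide) (by simp)
  exact not_not.mp hne ▸ hx

theorem exists_map_none_ne_none_of_closure_eq_top (hU : Subsemigroup.closure U = ⊤) :
    ∃ f ∈ U, f.1 none ≠ none :=
  Subsemigroup.exists_mem_not_of_closure_eq_top hU (p := fun f => f.1 none = none)
    (z := constDiag 0) (fun f g hf hg => (congrArg g.1 hf).trans hg) (by decide)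

end BrandtEnd

open BrandtEnd in
/-- The lower rank of `End(B_2)` (the minimum cardinality of a generating
subset) equals `3`. -/
theorem lower_rank_endB2 :
    IsLeast {k : ℕ | ∃ U : Set (BrandtEnd 2),
      Subsemigroup.closure U = ⊤ ∧ U.ncard = k} 3 := by
  have hne : swapEnd ≠ constZero := by decide
  refine ⟨⟨_, closure_generators_two,
    Set.ncard_eq_three.mpr ⟨_, _, _, hne, (by decide : swapEnd ≠ constDiag 0),
      (by decide : constZero ≠ constDiag 0), rfl⟩⟩, ?_⟩
  rintro _ ⟨U, hU, rfl⟩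
  obtain ⟨f, hf, hf0⟩ := exists_map_none_ne_none_of_closure_eq_top hU
  have hcard : ({swapEnd, constZero, f} : Set (BrandtEnd 2)).ncard = 3 :=
    Set.ncard_eq_three.mpr ⟨_, _, _, hne, by rintro rfl; exact hf0 rfl,
      by rintro rfl; exact hf0 rfl, rfl⟩
  rw [← hcard]
  refine Set.ncard_le_ncard ?_ (Set.toFinite U)
  rintro x (rfl | rfl | rfl)
  exacts [swapEnd_mem_of_closure_eq_top hU, constZero_mem_of_closure_eq_top hU, hf]
end
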